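/- arXiv:0704.2048 — 5 statements merged into one kernel-verified Lean document; each statement's English description precedes it below -/
import Mathlib

section
/- For every n ≥ 1 and every q with 1 ≤ q ≤ c_n − 1, the q-th and (q+1)-th permutations in the list 𝒟_n differ in at most 4 positions, i.e. d(𝒟_n(q), 𝒟_n(q+1)) ≤ 4 (in fact they differ by a cyclic rotation of two, three or four of their entries). -/
/-- The number of positions in which two permutations (as lists) differ. -/
def ddist (σ τ : List ℕ) : ℕ :=
  ((σ.zip τ).filter fun p => p.1 != p.2).length

/-- `A 1 = 0` and `A i = c_0 + ⋯ + c_{i-2}` for `i > 1`, `c_m` the Catalan numbers. -/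
def A (i : ℕ) : ℕ := ∑ m ∈ Finset.range (i - 1), catalan m

/-- `L^i`: the list `L` if `i` is odd, `L` reversed if `i` is even. -/
def alt (L : List (List ℕ)) (i : ℕ) : List (List ℕ) :=
  if i % 2 = 1 then L else L.reverse

/-- `L(j)`: the `j`-th entry of the list `L` (entries numbered from 1). -/
def ent (L : List (List ℕ)) (j : ℕ) : List ℕ := L.getD (j - 1) []

/-- The recursively defined list `𝒟_n`: `𝒟_0` consists of the empty permutation, and
`𝒟_n` is the concatenation over `i = 1,…,n`, `j = 1,…,c_{i-1}`, `k = 1,…,c_{n-i}` of the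
single permutation `[𝒟_{i-1}^{n+i-1}(j), n, 𝒟_{n-i}^{j+A(i)+1}(k) + (i-1)]`. -/
def Dlist : ℕ → List (List ℕ)
  | 0 => [[]]
  | n + 1 =>
    (List.range (n + 1)).attach.flatMap fun i =>
      (List.range (catalan i.1)).flatMap fun j =>
        (List.range (catalan (n - i.1))).flatMap fun k =>
          [ent (alt (Dlist i.1) (n + 1 + i.1)) (j + 1) ++
            (n + 1) ::
              (ent (alt (Dlist (n - i.1)) (j + 1 + A (i.1 + 1) + 1)) (k + 1)).map
                (· + i.1)]
decreasing_by
  · have := i.2; simp only [List.mem_range] at this; omega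
  · omega

/-- Two lists of the same length that differ in at most four positions. -/
def Close (σ τ : List ℕ) : Prop := σ.length = τ.length ∧ ddist σ τ ≤ 4

lemma ddist_cons (a b : ℕ) (σ τ : List ℕ) :
    ddist (a :: σ) (b :: τ) = (if a = b then 0 else 1) + ddist σ τ := by
  by_cases h : a = b <;> simp [ddist, h, Nat.add_comm]

lemma ddist_self (σ : List ℕ) : ddist σ σ = 0 := by
  induction σ with
  | nil => rfl
  | cons a σ ih => simp [ddist_cons, ih]

lemma ddist_comm (σ τ : List ℕ) : ddist σ τ = ddist τ σ := by
  induction σ generalizing τ with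
  | nil => cases τ <;> rfl
  | cons a σ ih =>
    cases τ with
    | nil => rfl
    | cons b τ => simp only [ddist_cons, ih τ, eq_comm]

lemma ddist_append {σ τ : List ℕ} (h : σ.length = τ.length) (σ' τ' : List ℕ) :
    ddist (σ ++ σ') (τ ++ τ') = ddist σ τ + ddist σ' τ' := by
  simp [ddist, List.zip_append h]

lemma ddist_append_left (ρ σ τ : List ℕ) : ddist (ρ ++ σ) (ρ ++ τ) = ddist σ τ := by
  rw [ddist_append rfl, ddist_self, Nat.zero_add]

lemma ddist_map_add (l : ℕ) (σ τ : List ℕ) :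
    ddist (σ.map (· + l)) (τ.map (· + l)) = ddist σ τ := by
  induction σ generalizing τ with
  | nil => rfl
  | cons a σ ih =>
    cases τ with
    | nil => rfl
    | cons b τ => simp only [List.map_cons, ddist_cons, ih τ, Nat.add_right_cancel_iff]

lemma Close.symm {σ τ : List ℕ} (h : Close σ τ) : Close τ σ :=
  ⟨h.1.symm, ddist_comm σ τ ▸ h.2⟩

/-- The permutation `[σ, m, τ + l]`. -/
def glue (m l : ℕ) (σ τ : List ℕ) : List ℕ := σ ++ m :: τ.map (· + l)

lemma Close.glue_right {τ τ' : List ℕ} (h : Close τ τ') (m l : ℕ) (σ : List ℕ) :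
    Close (glue m l σ τ) (glue m l σ τ') := by
  refine ⟨by simp [glue, h.1], ?_⟩
  simpa [glue, ddist_append_left, ddist_cons, ddist_map_add] using h.2

lemma Close.glue_left {σ σ' : List ℕ} (h : Close σ σ') (m l : ℕ) (τ : List ℕ) :
    Close (glue m l σ τ) (glue m l σ' τ) := by
  refine ⟨by simp [glue, h.1], ?_⟩
  simpa [glue, ddist_append h.1, ddist_self] using h.2

lemma alt_succ (L : List (List ℕ)) (s : ℕ) : alt L (s + 1) = (alt L s).reverse := by
  rcases Nat.mod_two_eq_zero_or_one s with h | h <;> simp [alt, Nat.add_mod, h]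

lemma length_alt (L : List (List ℕ)) (s : ℕ) : (alt L s).length = L.length := by
  unfold alt; split_ifs <;> simp

lemma alt_ne_nil {L : List (List ℕ)} (h : L ≠ []) (s : ℕ) : alt L s ≠ [] := by
  unfold alt; split_ifs <;> simpa

lemma isChain_alt {L : List (List ℕ)} (h : L.IsChain Close) (s : ℕ) :
    (alt L s).IsChain Close := by
  unfold alt
  split_ifs
  · exact h
  · exact List.isChain_reverse.2 (h.imp fun _ _ => Close.symm)

/-- For the successive entries `σ` of a list, the lists `f σ τ`, where `τ` runs alternately
forwards and backwards through `Q`. -/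
def zigzag (f : List ℕ → List ℕ → List ℕ) (Q : List (List ℕ)) :
    List (List ℕ) → ℕ → List (List ℕ)
  | [], _ => []
  | σ :: P, s => (alt Q s).map (f σ) ++ zigzag f Q P (s + 1)

lemma flatMap_range_length_ent (g : List ℕ → List ℕ) (Q : List (List ℕ)) :
    ((List.range Q.length).flatMap fun k => [g (ent Q (k + 1))]) = Q.map g := by
  rw [← List.map_eq_flatMap]
  apply List.ext_getElem <;> simp +contextual [ent]

lemma flatMap_range_eq_zigzag (f : List ℕ → List ℕ → List ℕ) (Q P : List (List ℕ)) (s : ℕ) :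
    ((List.range P.length).flatMap fun j => (List.range Q.length).flatMap fun k =>
      [f (ent P (j + 1)) (ent (alt Q (j + s)) (k + 1))]) = zigzag f Q P s := by
  induction P generalizing s with
  | nil => rfl
  | cons σ P ih =>
    rw [List.length_cons, List.range_succ_eq_map, List.flatMap_cons, List.flatMap_map, zigzag,
      ← ih, Nat.zero_add]
    congr 1
    · rw [← length_alt Q s, Nat.zero_add]
      exact flatMap_range_length_ent (f σ) _
    · simp only [Nat.succ_eq_add_one, Nat.add_right_comm _ 1, ← Nat.add_assoc]
      rfl

lemma length_zigzag (f : List ℕ → List ℕ → List ℕ) (Q P : List (List ℕ)) (s : ℕ) :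
    (zigzag f Q P s).length = P.length * Q.length := by
  induction P generalizing s with
  | nil => simp [zigzag]
  | cons σ P ih => simp [zigzag, ih, length_alt]; ring

lemma head?_zigzag (f : List ℕ → List ℕ → List ℕ) {Q P : List (List ℕ)} (s : ℕ)
    {σ τ : List ℕ} (hP : P.head? = some σ) (hQ : (alt Q s).head? = some τ) :
    (zigzag f Q P s).head? = some (f σ τ) := by
  cases P with
  | nil => simp at hP
  | cons ρ P =>
    obtain rfl : ρ = σ := by simpa using hP
    simp [zigzag, hQ]

lemma getLast?_zigzag (f : List ℕ → List ℕ → List ℕ) {Q P : List (List ℕ)} (s : ℕ)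
    {σ τ : List ℕ} (hP : P.getLast? = some σ)
    (hQ : (alt Q (s + P.length)).head? = some τ) :
    (zigzag f Q P s).getLast? = some (f σ τ) := by
  induction P generalizing s with
  | nil => simp at hP
  | cons ρ P ih =>
    cases P with
    | nil =>
      obtain rfl : ρ = σ := by simpa using hP
      have : (alt Q s).getLast? = some τ := by simpa [alt_succ] using hQ
      simp [zigzag, this]
    | cons ρ' P =>
      rw [zigzag, List.getLast?_append, ih (s + 1) (by simpa using hP)]
      · rfl
      · rw [← hQ]
        congr 2
        simp
        ring

lemma isChain_zigzag (m l : ℕ) {Q P : List (List ℕ)} (hQ : Q.IsChain Close) (hQ' : Q ≠ [])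
    (hP : P.IsChain Close) (s : ℕ) : (zigzag (glue m l) Q P s).IsChain Close := by
  induction P generalizing s with
  | nil => exact .nil
  | cons σ P ih =>
    rw [zigzag, List.isChain_append]
    refine ⟨?_, ih hP.tail _, ?_⟩
    · exact (List.isChain_map _).2 ((isChain_alt hQ s).imp fun _ _ h => h.glue_right m l σ)
    · cases P with
      | nil => simp [zigzag]
      | cons σ' P =>
        obtain ⟨τ, hτ⟩ : ∃ τ, (alt Q (s + 1)).head? = some τ :=
          ⟨_, List.head?_eq_some_head (alt_ne_nil hQ' _)⟩
        have hτ' : (alt Q s).getLast? = some τ := by simpa [alt_succ] using hτ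
        rw [head?_zigzag _ _ rfl hτ, List.getLast?_map, hτ']
        rintro _ ⟨⟩ _ ⟨⟩
        exact (List.isChain_cons_cons.1 hP).1.glue_left m l τ

/-- The identity permutation of `{1, …, n}`. -/
def idPerm (n : ℕ) : List ℕ := List.range' 1 n

/-- The permutation `n, 1, …, n - 1`. -/
def cyclePerm : ℕ → List ℕ
  | 0 => []
  | n + 1 => (n + 1) :: idPerm n

/-- The two extremal permutations of `𝒟_n`: the identity and `n, 1, …, n - 1`. -/
def extremePerm (b : Bool) (n : ℕ) : List ℕ := if b then idPerm n else cyclePerm n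

lemma length_extremePerm (b : Bool) (n : ℕ) : (extremePerm b n).length = n := by
  cases b <;> cases n <;> simp [extremePerm, cyclePerm, idPerm]

lemma idPerm_succ (n : ℕ) : idPerm (n + 1) = idPerm n ++ [n + 1] := by
  simp [idPerm, List.range'_1_concat, Nat.add_comm]

lemma map_idPerm_succ (l n : ℕ) :
    (idPerm (n + 1)).map (· + l) = (l + 1) :: (idPerm n).map (· + (l + 1)) := by
  simp only [idPerm, Nat.add_comm _ l, Nat.add_comm _ (l + 1), List.map_add_range']
  rfl

lemma ddist_glue_extremePerm_le_three (N m p q : ℕ) (c : Bool) :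
    ddist (N :: (extremePerm c (q + 1)).map (· + p))
      (m :: N :: (extremePerm c q).map (· + (p + 1))) ≤ 3 := by
  cases c
  · cases q with
    | zero =>
      simp only [extremePerm, cyclePerm, idPerm, List.range'_zero, List.map_cons, List.map_nil,
        Bool.false_eq_true, if_false, ddist_cons, ddist_self]
      split_ifs <;> omega
    | succ q =>
      simp only [extremePerm, cyclePerm, List.map_cons, map_idPerm_succ, ddist_cons, ddist_self,
        Bool.false_eq_true, if_false]
      split_ifs <;> omega
  · simp only [extremePerm, if_true, map_idPerm_succ, ddist_cons, ddist_self]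
    split_ifs <;> omega

lemma close_glue_extremePerm (N p q : ℕ) (b c : Bool) :
    Close (glue N p (extremePerm b p) (extremePerm c (q + 1)))
      (glue N (p + 1) (extremePerm b (p + 1)) (extremePerm c q)) := by
  refine ⟨by simp [glue, length_extremePerm]; ring, ?_⟩
  have h := fun m => ddist_glue_extremePerm_le_three N m p q c
  unfold glue
  cases b
  · cases p with
    | zero => simpa [extremePerm, cyclePerm, idPerm] using (h 1).trans (Nat.le_succ 3)
    | succ p =>
      have e : ∀ x y, ddist (extremePerm false (p + 1) ++ x) (extremePerm false (p + 1 + 1) ++ y)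
          ≤ 1 + ddist x ((p + 1) :: y) := by
        intro x y
        simp only [extremePerm, cyclePerm, idPerm_succ, List.cons_append, List.append_assoc,
          Bool.false_eq_true, if_false, ddist_cons, ddist_append_left, List.nil_append]
        split_ifs <;> omega
      exact (e _ _).trans (Nat.add_le_add_left (h _) 1)
  · have e : ∀ n, extremePerm true n = idPerm n := fun _ => rfl
    simp only [e, idPerm_succ, List.append_assoc, ddist_append_left]
    exact (h _).trans (Nat.le_succ 3)

lemma Dlist_zero : Dlist 0 = [[]] := by rw [Dlist]

/-- The part of `𝒟_{n+1}` whose permutations have their maximum in position `i`, counting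
from zero. -/
def block (n i : ℕ) : List (List ℕ) :=
  zigzag (glue (n + 1) i) (Dlist (n - i)) (alt (Dlist i) (n + 1 + i)) (A (i + 1) + 2)

lemma Dlist_succ_of_length (n : ℕ) (h : ∀ m ≤ n, (Dlist m).length = catalan m) :
    Dlist (n + 1) = (List.range (n + 1)).flatMap (block n) := by
  rw [Dlist]
  conv_rhs => rw [← List.attach_map_subtype_val (List.range (n + 1)), List.flatMap_map]
  congr 1
  funext ⟨i, hi⟩
  have hi' : i ≤ n := by simpa [Nat.lt_succ_iff] using hi
  rw [block, ← flatMap_range_eq_zigzag, length_alt, h i hi', h _ (Nat.sub_le n i)]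
  simp only [glue]
  congr 1
  funext j
  rw [show j + 1 + A (i + 1) + 1 = j + (A (i + 1) + 2) by ring]

lemma A_succ (i : ℕ) : A (i + 2) = A (i + 1) + catalan i := by
  simp [A, Finset.sum_range_succ]

/-- The properties of `𝒟_n` carried through the recursion. -/
structure DlistSpec (n : ℕ) : Prop where
  length : (Dlist n).length = catalan n
  head : (Dlist n).head? = some (extremePerm false n)
  getLast : (Dlist n).getLast? = some (extremePerm true n)
  isChain : (Dlist n).IsChain Close

lemma DlistSpec.ne_nil {n : ℕ} (h : DlistSpec n) : Dlist n ≠ [] := by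
  intro h0
  simpa [h0] using h.head

lemma DlistSpec.head?_alt {n : ℕ} (h : DlistSpec n) (s : ℕ) :
    (alt (Dlist n) s).head? = some (extremePerm (s % 2 = 0) n) := by
  rcases Nat.mod_two_eq_zero_or_one s with hs | hs <;> simp [alt, hs, h.head, h.getLast]

lemma DlistSpec.getLast?_alt {n : ℕ} (h : DlistSpec n) (s : ℕ) :
    (alt (Dlist n) s).getLast? = some (extremePerm (s % 2 = 1) n) := by
  rcases Nat.mod_two_eq_zero_or_one s with hs | hs <;> simp [alt, hs, h.head, h.getLast]

lemma head?_block {n i : ℕ} (hi : DlistSpec i) (hni : DlistSpec (n - i)) :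
    (block n i).head? = some (glue (n + 1) i (extremePerm ((n + 1 + i) % 2 = 0) i)
      (extremePerm (A (i + 1) % 2 = 0) (n - i))) := by
  rw [block, head?_zigzag _ _ (hi.head?_alt _) (hni.head?_alt _), Nat.add_mod_right]

lemma getLast?_block {n i : ℕ} (hi : DlistSpec i) (hni : DlistSpec (n - i)) :
    (block n i).getLast? = some (glue (n + 1) i (extremePerm ((n + 1 + i) % 2 = 1) i)
      (extremePerm (A (i + 2) % 2 = 0) (n - i))) := by
  rw [block, getLast?_zigzag _ _ (hi.getLast?_alt _) (hni.head?_alt _), length_alt, hi.length,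
    Nat.add_right_comm _ 2, ← A_succ, Nat.add_mod_right]

lemma DlistSpec.succ {n : ℕ} (h : ∀ m ≤ n, DlistSpec m) : DlistSpec (n + 1) := by
  have hD := Dlist_succ_of_length n fun m hm => (h m hm).length
  refine ⟨?_, ?_, ?_, ?_⟩
  · rw [hD, List.length_flatMap, catalan_succ,
      Fin.sum_univ_eq_sum_range (fun i => catalan i * catalan (n - i)), Finset.sum_range]
    rw [← List.sum_ofFn, List.ofFn_eq_map, ← List.map_coe_finRange_eq_range, List.map_map]
    congr 1
    apply List.map_congr_left
    intro i _
    simp [block, length_zigzag, length_alt, (h i (by omega)).length, (h _ (Nat.sub_le n i)).length]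
  · rw [hD, List.range_succ_eq_map, List.flatMap_cons, List.head?_append,
      head?_block (h 0 (Nat.zero_le n)) (h _ (Nat.sub_le n 0))]
    simp [A, extremePerm, cyclePerm, glue, idPerm]
  · rw [hD, List.range_succ, List.flatMap_append, List.getLast?_append, List.flatMap_singleton,
      getLast?_block (h n le_rfl) (h _ (Nat.sub_le n n))]
    have : (n + 1 + n) % 2 = 1 := by omega
    cases decide (A (n + 2) % 2 = 0) <;>
      simp [this, extremePerm, cyclePerm, glue, idPerm_succ, show idPerm 0 = [] from rfl]
  · rw [hD, List.flatMap, List.isChain_flatten, List.isChain_map, List.isChain_range_succ]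
    · refine ⟨?_, ?_⟩
      · simp only [List.mem_map, List.mem_range, Nat.lt_succ_iff]
        rintro _ ⟨i, hi, rfl⟩
        exact isChain_zigzag _ _ (h _ (Nat.sub_le n i)).isChain (h _ (Nat.sub_le n i)).ne_nil
          (isChain_alt (h i hi).isChain _) _
      · intro i hi
        rw [Nat.succ_eq_add_one, getLast?_block (h i hi.le) (h _ (Nat.sub_le n i)),
          head?_block (h _ hi) (h _ (Nat.sub_le n _))]
        rintro _ ⟨⟩ _ ⟨⟩
        have e : n - i = n - (i + 1) + 1 := by omega
        have e' : decide ((n + 1 + (i + 1)) % 2 = 0) = decide ((n + 1 + i) % 2 = 1) := by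
          congr 1
          apply propext
          omega
        rw [e, e']
        exact close_glue_extremePerm _ _ _ _ _
    · simp only [List.mem_map, List.mem_range, Nat.lt_succ_iff, not_exists, not_and]
      intro i hi h0
      simpa [h0] using head?_block (h i hi) (h _ (Nat.sub_le n i))

lemma dlistSpec (n : ℕ) : DlistSpec n := by
  induction n using Nat.strong_induction_on with
  | _ n ih =>
    cases n with
    | zero => exact ⟨by simp [Dlist_zero], by simp [Dlist_zero, extremePerm, cyclePerm],
        by simp [Dlist_zero, extremePerm, idPerm], by simp [Dlist_zero]⟩
    | succ n => exact .succ fun m hm => ih m (Nat.lt_succ_of_le hm)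

/-- Consecutive permutations in the list `𝒟_n` differ in at most 4 positions. -/
theorem Dlist_consecutive_ddist_le_four :
    ∀ n : ℕ, 1 ≤ n → ∀ q : ℕ, 1 ≤ q → q ≤ catalan n - 1 →
      ddist (ent (Dlist n) q) (ent (Dlist n) (q + 1)) ≤ 4 := by
  intro n _ q hq hqn
  have h := dlistSpec n
  have hlt : q - 1 + 1 < (Dlist n).length := by
    rw [h.length]
    omega
  have hq' : q + 1 - 1 = q - 1 + 1 := by omega
  rw [ent, ent, hq', List.getD_eq_getElem _ _ hlt,
    List.getD_eq_getElem _ _ (Nat.lt_of_succ_lt hlt)]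
  exact (List.isChain_iff_getElem.1 h.isChain (q - 1) hlt).2
end

section
/- For all n ≥ 2, the first entry of the list 𝒟_n is the permutation n 1 2 3 ⋯ (n−1) and the last entry 𝒟_n(c_n) is the identity permutation 1 2 3 ⋯ n. -/
theorem catalan_pos (n : ℕ) : 0 < catalan n := by
  have h := succ_mul_catalan_eq_centralBinom n
  have := Nat.centralBinom_pos n
  exact Nat.pos_of_mul_pos_left (h ▸ this)

theorem Dlist_succ (n : ℕ) :
    Dlist (n + 1) =
      (List.range (n + 1)).flatMap fun i =>
        (List.range (catalan i)).flatMap fun j =>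
          (List.range (catalan (n - i))).flatMap fun k =>
            [ent (alt (Dlist i) (n + 1 + i)) (j + 1) ++
              (n + 1) ::
                (ent (alt (Dlist (n - i)) (j + 1 + A (i + 1) + 1)) (k + 1)).map (· + i)] := by
  rw [Dlist]
  conv_rhs => rw [← List.attach_map_subtype_val (List.range (n + 1)), List.flatMap_map]

theorem length_Dlist (n : ℕ) : (Dlist n).length = catalan n := by
  cases n with
  | zero => simp [Dlist]
  | succ n =>
    rw [Dlist_succ, catalan_succ, Finset.sum_fin_eq_sum_range]
    simp only [List.length_flatMap, List.length_singleton, List.map_const', List.sum_replicate,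
      List.length_range, smul_eq_mul, mul_one]
    rw [← List.sum_toFinset _ List.nodup_range, List.toFinset_range]
    refine Finset.sum_congr rfl fun i hi => ?_
    rw [dif_pos (Finset.mem_range.mp hi)]

theorem ent_one (L : List (List ℕ)) : ent L 1 = L.head?.getD [] := by
  cases L <;> rfl

theorem ent_length (L : List (List ℕ)) : ent L L.length = L.getLast?.getD [] := by
  simp [ent, List.getLast?_eq_getElem?]

theorem ent_one_Dlist_succ (n : ℕ) :
    ent (Dlist (n + 1)) 1 = (n + 1) :: ent (Dlist n) (catalan n) := by
  obtain ⟨c, hc⟩ := Nat.exists_eq_add_one.mpr (catalan_pos n)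
  rw [← length_Dlist n, ent_length, ent_one, Dlist_succ]
  simp [List.range_succ_eq_map, hc, alt, A, ent_one, Dlist]

theorem ent_catalan_Dlist_succ (n : ℕ) :
    ent (Dlist (n + 1)) (catalan (n + 1)) = ent (Dlist n) (catalan n) ++ [n + 1] := by
  obtain ⟨c, hc⟩ := Nat.exists_eq_add_one.mpr (catalan_pos n)
  have hodd : (n + 1 + n) % 2 = 1 := by omega
  rw [← length_Dlist (n + 1), ent_length, Dlist_succ, List.range_succ]
  simp [List.range_succ, hc, alt, ent_one, Dlist, hodd]

theorem ent_catalan_Dlist (n : ℕ) : ent (Dlist n) (catalan n) = List.range' 1 n := by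
  induction n with
  | zero => simp [Dlist, ent]
  | succ n ih => rw [ent_catalan_Dlist_succ, ih, List.range'_concat]; simp [add_comm]

/-- For `n ≥ 2`, the first entry of `𝒟_n` is `n 1 2 ⋯ (n-1)` and the last entry
`𝒟_n(c_n)` is the identity `1 2 ⋯ n`. -/
theorem Dlist_first_and_last :
    ∀ n : ℕ, 2 ≤ n →
      ent (Dlist n) 1 = n :: List.range' 1 (n - 1) ∧
      ent (Dlist n) (catalan n) = List.range' 1 n := by
  intro n hn
  obtain ⟨m, rfl⟩ : ∃ m, n = m + 1 := ⟨n - 1, by omega⟩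
  exact ⟨by rw [ent_one_Dlist_succ, ent_catalan_Dlist, Nat.add_sub_cancel], ent_catalan_Dlist _⟩
end

section
/- Let A(1) = 0 and A(i) = c_0 + c_1 + ⋯ + c_{i−2} for i > 1, where c_m is the m-th Catalan number. Then for all n ≥ 0 and all k with 0 < k ≤ 2^n, the number A(2^n + k) is odd if and only if n is even. -/
open Finset.HasAntidiagonal (antidiagonal mem_antidiagonal)

/-- A sum of `f i * f j` over the antidiagonal of `n` in characteristic two reduces to the terms
on the diagonal `i = j`. -/
theorem sum_antidiagonal_mul_eq_sum_filter {R : Type*} [CommRing R] [CharP R 2]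
    (f : ℕ → R) (n : ℕ) :
    ∑ p ∈ antidiagonal n, f p.1 * f p.2 =
      ∑ p ∈ antidiagonal n with p.1 = p.2, f p.1 * f p.2 := by
  rw [← Finset.sum_filter_add_sum_filter_not (antidiagonal n) (fun p => p.1 = p.2),
    add_eq_left]
  refine Finset.sum_involution (fun p _ => p.swap) (fun p _ => ?_) (fun p hp _ h => ?_)
    (fun p hp => ?_) (fun p _ => p.swap_swap)
  · rw [Prod.fst_swap, Prod.snd_swap, mul_comm (f p.2), CharTwo.add_self_eq_zero]
  · exact (Finset.mem_filter.1 hp).2 (congrArg Prod.snd h)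
  · simp only [Finset.mem_filter, mem_antidiagonal, Prod.fst_swap, Prod.snd_swap] at hp ⊢
    exact ⟨by omega, Ne.symm hp.2⟩

theorem catalan_two_mul_add_one_cast_zmod_two (m : ℕ) :
    (catalan (2 * m + 1) : ZMod 2) = catalan m := by
  have hdiag : (antidiagonal (2 * m)).filter (fun p => p.1 = p.2) = {(m, m)} := by
    ext ⟨a, b⟩
    simp only [Finset.mem_filter, mem_antidiagonal, Finset.mem_singleton, Prod.mk.injEq]
    omega
  rw [catalan_succ']
  push_cast
  rw [sum_antidiagonal_mul_eq_sum_filter (fun i => (catalan i : ZMod 2)), hdiag,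
    Finset.sum_singleton, ← sq, ZMod.pow_card]

theorem catalan_two_mul_add_two_cast_zmod_two (m : ℕ) :
    (catalan (2 * m + 2) : ZMod 2) = 0 := by
  have hdiag : (antidiagonal (2 * m + 1)).filter (fun p => p.1 = p.2) = ∅ := by
    ext ⟨a, b⟩
    simp only [Finset.mem_filter, mem_antidiagonal, Finset.notMem_empty, iff_false]
    omega
  rw [catalan_succ']
  push_cast
  rw [sum_antidiagonal_mul_eq_sum_filter (fun i => (catalan i : ZMod 2)), hdiag,
    Finset.sum_empty]

theorem sum_range_two_mul_catalan_cast_zmod_two (m : ℕ) :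
    ∑ i ∈ Finset.range (2 * m + 2), (catalan i : ZMod 2) =
      ∑ i ∈ Finset.range (m + 1), (catalan i : ZMod 2) + 1 := by
  induction m with
  | zero => simp [Finset.sum_range_succ]
  | succ m ih =>
    rw [show 2 * (m + 1) + 2 = 2 * m + 2 + 1 + 1 by ring, Finset.sum_range_succ,
      Finset.sum_range_succ, ih, catalan_two_mul_add_two_cast_zmod_two,
      show 2 * m + 2 + 1 = 2 * (m + 1) + 1 by ring, catalan_two_mul_add_one_cast_zmod_two,
      Finset.sum_range_succ _ (m + 1)]
    ring

/-- Modulo two, the sum of the first `N` Catalan numbers is the number of binary digits of `N`. -/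
theorem sum_range_catalan_cast_zmod_two {N : ℕ} (hN : N ≠ 0) :
    ∑ i ∈ Finset.range N, (catalan i : ZMod 2) = Nat.log 2 N + 1 := by
  induction N using Nat.strong_induction_on with
  | _ N ih =>
    obtain rfl | hN2 : N = 1 ∨ 2 ≤ N := by omega
    · simp
    obtain ⟨m, hm⟩ : ∃ m, N / 2 = m + 1 := ⟨N / 2 - 1, by omega⟩
    have hlog : Nat.log 2 N = Nat.log 2 (m + 1) + 1 := by
      rw [Nat.log_of_one_lt_of_le one_lt_two hN2, hm]
    have hhalf := ih (m + 1) (by omega) m.succ_ne_zero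
    rw [hlog, Nat.cast_succ, ← hhalf, ← sum_range_two_mul_catalan_cast_zmod_two]
    obtain rfl | rfl : N = 2 * m + 2 ∨ N = 2 * m + 2 + 1 := by omega
    · rfl
    · rw [Finset.sum_range_succ, catalan_two_mul_add_two_cast_zmod_two, add_zero]

/-- For all `n ≥ 0` and `0 < k ≤ 2^n`, the number `A(2^n + k)` is odd iff `n` is even. -/
theorem A_odd_iff (n k : ℕ) (hk : 0 < k) (hk' : k ≤ 2 ^ n) :
    Odd (A (2 ^ n + k)) ↔ Even n := by
  have hlog : Nat.log 2 (2 ^ n + k - 1) = n :=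
    Nat.log_eq_of_pow_le_of_lt_pow (by omega) (by rw [pow_succ]; omega)
  have hne : 2 ^ n + k - 1 ≠ 0 := by have := Nat.two_pow_pos n; omega
  have hA : (A (2 ^ n + k) : ZMod 2) = ((n + 1 : ℕ) : ZMod 2) := by
    rw [A, Nat.cast_sum, sum_range_catalan_cast_zmod_two hne, hlog, Nat.cast_succ]
  rw [← ZMod.natCast_eq_one_iff_odd, hA, ZMod.natCast_eq_one_iff_odd, Nat.odd_add_one,
    Nat.not_odd_iff_even]
end

section
/- For every n ≥ 1 and every permutation π of {1,…,n} avoiding both patterns 321 and 312, a site i of π is active (for T = {321,312}) if and only if i ∈ {1,2}; that is, inserting n+1 at the end or immediately before the last entry of π preserves avoidance of both patterns, while inserting n+1 into any other site creates an occurrence of 321 or 312. Consequently, the number of permutations of {1,…,n} avoiding both 321 and 312 equals 2^{n−1}. -/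
/-- `π` is a permutation of `{1,…,n}` (written as the list of its values). -/
def IsPermOf (n : ℕ) (π : List ℕ) : Prop := π.Perm (List.range' 1 n)

/-- The lists `s` and `τ` have the same length and are order-isomorphic. -/
def OrderIsomorphic (s τ : List ℕ) : Prop :=
  s.length = τ.length ∧ ∀ i j : ℕ, i < s.length → j < s.length →
    (s.getD i 0 < s.getD j 0 ↔ τ.getD i 0 < τ.getD j 0)

/-- `π` avoids the pattern `τ`: no subsequence of `π` is order-isomorphic to `τ`. -/
def Avoids (π τ : List ℕ) : Prop := ¬∃ s : List ℕ, s.Sublist π ∧ OrderIsomorphic s τ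

/-- `π` avoids every pattern in the set `T`. -/
def AvoidsAll (T : Set (List ℕ)) (π : List ℕ) : Prop := ∀ τ ∈ T, Avoids π τ

/-- Insert the value `n+1` into site `i` of a permutation `π` of `{1,…,n}`; sites are
numbered from right to left from `1` to `n+1`, so the new value gets exactly `i-1`
entries of `π` to its right. -/
def insertSite (π : List ℕ) (i : ℕ) : List ℕ :=
  π.take (π.length + 1 - i) ++ (π.length + 1) :: π.drop (π.length + 1 - i)

/-- Site `i` of `π` is active with respect to the forbidden patterns `T`: inserting the
next-largest value into site `i` produces a permutation avoiding all patterns of `T`. -/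
def ActiveSite (T : Set (List ℕ)) (π : List ℕ) (i : ℕ) : Prop :=
  1 ≤ i ∧ i ≤ π.length + 1 ∧ AvoidsAll T (insertSite π i)

/-- The number of active sites of `π` with respect to `T`. -/
noncomputable def numActive (T : Set (List ℕ)) (π : List ℕ) : ℕ :=
  {i : ℕ | ActiveSite T π i}.ncard

/-- A set of patterns `T` is regular if every `π ∈ 𝔖_n(T)` (for every `n ≥ 1`) has at
least two active sites, its active sites are right justified, and the number of active
sites of the permutation obtained by inserting `n+1` into the `i`-th active site
depends only on `i` and the number of active sites of `π`, not on `π` itself. -/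
def Regular (T : Set (List ℕ)) : Prop :=
  (∀ n : ℕ, 1 ≤ n → ∀ π : List ℕ, IsPermOf n π → AvoidsAll T π →
    2 ≤ numActive T π ∧
      ∀ i j : ℕ, ActiveSite T π i → 1 ≤ j → j ≤ i → ActiveSite T π j) ∧
  (∀ n m : ℕ, ∀ π ρ : List ℕ, 1 ≤ n → 1 ≤ m → IsPermOf n π → IsPermOf m ρ →
    AvoidsAll T π → AvoidsAll T ρ → numActive T π = numActive T ρ →
    ∀ i : ℕ, 1 ≤ i → i ≤ numActive T π →
      numActive T (insertSite π i) = numActive T (insertSite ρ i))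

/-- The unimodal sequence `L_k`: `1,3,5,…,k,(k-1),(k-3),…,4,2` when `k` is odd and
`1,3,5,…,(k-1),k,(k-2),…,4,2` when `k` is even (the odd numbers in `{1,…,k}` in
increasing order followed by the even ones in decreasing order). -/
def Lseq (k : ℕ) : List ℕ :=
  ((List.range (k + 1)).filter fun x => x % 2 == 1) ++
    (((List.range (k + 1)).filter fun x => x % 2 == 0 && x != 0).reverse)

/-- The list of successors `φ(π^1)` of the upward-directed permutation `π^1` (directions
are recorded as a `Bool`, `true` = up, `false` = down): its `j`-th element is obtained
from `π` by inserting the next-largest value into the `L_k(j)`-th active site (which is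
site `L_k(j)`, since active sites are right justified), where `k` is the number of
active sites of `π`; the first successor is directed up and all others down. -/
noncomputable def phiUp (T : Set (List ℕ)) (π : List ℕ) : List (List ℕ × Bool) :=
  match (Lseq (numActive T π)).map (fun i => insertSite π i) with
  | [] => []
  | a :: rest => (a, true) :: rest.map fun x => (x, false)

/-- The list of successors of a directed permutation: `φ(π^0)` is `φ(π^1)` reversed
with every direction flipped. -/
noncomputable def phi (T : Set (List ℕ)) (p : List ℕ × Bool) : List (List ℕ × Bool) :=
  if p.2 then phiUp T p.1
  else ((phiUp T p.1).map fun q => (q.1, !q.2)).reverse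

/-- The list `𝒞_n(T)` of directed permutations: `𝒞_1 = ((1)^1)` and `𝒞_n` is the
concatenation of the lists of successors of the entries of `𝒞_{n-1}`. -/
noncomputable def Cl (T : Set (List ℕ)) : ℕ → List (List ℕ × Bool)
  | 0 => []
  | 1 => [([1], true)]
  | n + 2 => (Cl T (n + 1)).flatMap (phi T)

/-- No entry of `π` is followed by two smaller entries. -/
def NoTwoSmallerAfter (π : List ℕ) : Prop :=
  ∀ a b c : ℕ, [a, b, c].Sublist π → b < a → ¬c < a

theorem orderIsomorphic_321_iff (a b c : ℕ) :
    OrderIsomorphic [a, b, c] [3, 2, 1] ↔ c < b ∧ b < a := by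
  constructor
  · rintro ⟨-, h⟩
    have h₁ := h 2 1 (by simp) (by simp)
    have h₂ := h 1 0 (by simp) (by simp)
    simp at h₁ h₂
    exact ⟨h₁, h₂⟩
  · rintro ⟨h₁, h₂⟩
    refine ⟨rfl, fun i j hi hj => ?_⟩
    simp only [List.length_cons, List.length_nil] at hi hj
    interval_cases i <;> interval_cases j <;> simp <;> omega

theorem orderIsomorphic_312_iff (a b c : ℕ) :
    OrderIsomorphic [a, b, c] [3, 1, 2] ↔ b < c ∧ c < a := by
  constructor
  · rintro ⟨-, h⟩
    have h₁ := h 1 2 (by simp) (by simp)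
    have h₂ := h 2 0 (by simp) (by simp)
    simp at h₁ h₂
    exact ⟨h₁, h₂⟩
  · rintro ⟨h₁, h₂⟩
    refine ⟨rfl, fun i j hi hj => ?_⟩
    simp only [List.length_cons, List.length_nil] at hi hj
    interval_cases i <;> interval_cases j <;> simp <;> omega

theorem avoidsAll_321_312_iff {π : List ℕ} (hπ : π.Nodup) :
    AvoidsAll ({[3, 2, 1], [3, 1, 2]} : Set (List ℕ)) π ↔ NoTwoSmallerAfter π := by
  constructor
  · intro h a b c hs hb hc
    have hne : b ≠ c := by
      have := hs.nodup hπ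
      simp at this
      tauto
    rcases lt_or_gt_of_ne hne with hbc | hcb
    · exact h [3, 1, 2] (by simp) ⟨_, hs, (orderIsomorphic_312_iff a b c).2 ⟨hbc, hc⟩⟩
    · exact h [3, 2, 1] (by simp) ⟨_, hs, (orderIsomorphic_321_iff a b c).2 ⟨hcb, hb⟩⟩
  · rintro h τ hτ ⟨s, hs, hiso⟩
    simp only [Set.mem_insert_iff, Set.mem_singleton_iff] at hτ
    have hlen : s.length = 3 := by
      rcases hτ with rfl | rfl <;> simpa using hiso.1
    obtain ⟨a, b, c, rfl⟩ := List.length_eq_three.1 hlen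
    rcases hτ with rfl | rfl
    · obtain ⟨hcb, hba⟩ := (orderIsomorphic_321_iff a b c).1 hiso
      exact h a b c hs hba (hcb.trans hba)
    · obtain ⟨hbc, hca⟩ := (orderIsomorphic_312_iff a b c).1 hiso
      exact h a b c hs (hbc.trans hca) hca

theorem noTwoSmallerAfter_append_cons_iff {A B : List ℕ} {m : ℕ}
    (hA : ∀ x ∈ A, x < m) (hB : ∀ x ∈ B, x < m) :
    NoTwoSmallerAfter (A ++ m :: B) ↔ NoTwoSmallerAfter (A ++ B) ∧ B.length ≤ 1 := by
  constructor
  · intro h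
    refine ⟨fun a b c hs => h a b c
      (hs.trans ((List.sublist_cons_self m B).append_left A)), ?_⟩
    match B, hB, h with
    | [], _, _ => simp
    | [_], _, _ => simp
    | b :: c :: B, hB, h =>
      refine absurd (hB c (by simp)) (h m b c ?_ (hB b (by simp)))
      exact List.Sublist.trans (by simp) (List.sublist_append_right A _)
  · rintro ⟨h, hlen⟩ a b c hs hb hc
    have ha : a ≤ m := by
      have := hs.subset (show a ∈ [a, b, c] by simp)
      simp only [List.mem_append, List.mem_cons] at this
      rcases this with h | h | h
      · exact (hA a h).le
      · exact h.le
      · exact (hB a h).le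
    obtain ⟨s₁, s₂, hs₁₂, h₁, h₂⟩ := List.sublist_append_iff.1 hs
    rcases List.sublist_cons_iff.1 h₂ with h₂ | ⟨s₃, rfl, h₃⟩
    · exact h a b c (hs₁₂ ▸ h₁.append h₂) hb hc
    · have hl₃ := h₃.length_le
      have hm : m ∉ [b, c] := by simp; omega
      cases s₁ with
      | nil =>
        have := congrArg List.length hs₁₂
        simp at this
        omega
      | cons x s₁ =>
        refine hm ?_
        simp only [List.cons_append, List.cons.injEq] at hs₁₂
        simp [hs₁₂.2]

theorem IsPermOf.nodup {n : ℕ} {π : List ℕ} (h : IsPermOf n π) : π.Nodup :=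
  h.nodup_iff.2 List.nodup_range'

theorem IsPermOf.length_eq {n : ℕ} {π : List ℕ} (h : IsPermOf n π) : π.length = n := by
  simpa using List.Perm.length_eq h

theorem IsPermOf.lt_of_mem {n x : ℕ} {π : List ℕ} (h : IsPermOf n π) (hx : x ∈ π) :
    x < n + 1 := by
  have := (List.Perm.mem_iff h).1 hx
  rw [List.mem_range'_1] at this
  omega

theorem isPermOf_append_cons_iff {n : ℕ} {A B : List ℕ} :
    IsPermOf (n + 1) (A ++ (n + 1) :: B) ↔ IsPermOf n (A ++ B) := by
  unfold IsPermOf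
  rw [List.range'_1_concat, add_comm 1 n]
  constructor
  · intro h
    exact (List.perm_cons (n + 1)).1
      (List.perm_middle.symm.trans (h.trans (List.perm_append_singleton _ _)))
  · intro h
    exact List.perm_middle.trans ((h.cons _).trans (List.perm_append_singleton _ _).symm)

theorem isPermOf_insertSite {n : ℕ} {π : List ℕ} (h : IsPermOf n π) (i : ℕ) :
    IsPermOf (n + 1) (insertSite π i) := by
  rw [insertSite, h.length_eq, isPermOf_append_cons_iff, List.take_append_drop]
  exact h

theorem avoidsAll_insertSite_iff {n i : ℕ} {π : List ℕ} (h : IsPermOf n π)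
    (hi₁ : 1 ≤ i) (hi₂ : i ≤ n + 1) :
    AvoidsAll ({[3, 2, 1], [3, 1, 2]} : Set (List ℕ)) (insertSite π i) ↔
      AvoidsAll ({[3, 2, 1], [3, 1, 2]} : Set (List ℕ)) π ∧ i ≤ 2 := by
  rw [avoidsAll_321_312_iff (isPermOf_insertSite h i).nodup, avoidsAll_321_312_iff h.nodup,
    insertSite, h.length_eq, noTwoSmallerAfter_append_cons_iff
      (fun x hx => h.lt_of_mem (List.mem_of_mem_take hx))
      (fun x hx => h.lt_of_mem (List.mem_of_mem_drop hx)),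
    List.take_append_drop, List.length_drop, h.length_eq]
  exact and_congr_right fun _ => by omega

theorem exists_eq_insertSite {n : ℕ} {π : List ℕ} (h : IsPermOf (n + 1) π) :
    ∃ ρ i, IsPermOf n ρ ∧ 1 ≤ i ∧ i ≤ n + 1 ∧ insertSite ρ i = π := by
  have hmem : n + 1 ∈ π := (List.Perm.mem_iff h).2 (List.mem_range'_1.2 (by omega))
  obtain ⟨A, B, rfl⟩ := List.append_of_mem hmem
  have hρ := isPermOf_append_cons_iff.1 h
  have hlen := hρ.length_eq
  rw [List.length_append] at hlen
  refine ⟨A ++ B, B.length + 1, hρ, by omega, by omega, ?_⟩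
  have hk : n + 1 - (B.length + 1) = A.length := by omega
  rw [insertSite, hρ.length_eq, hk, List.take_left, List.drop_left]

theorem erase_insertSite {n : ℕ} {π : List ℕ} (h : IsPermOf n π) (i : ℕ) :
    (insertSite π i).erase (n + 1) = π := by
  have hA : n + 1 ∉ π.take (n + 1 - i) := fun hx =>
    (h.lt_of_mem (List.mem_of_mem_take hx)).false
  rw [insertSite, h.length_eq, List.erase_append_right _ hA, List.erase_cons_head,
    List.take_append_drop]

theorem idxOf_insertSite {n i : ℕ} {π : List ℕ} (h : IsPermOf n π) (hi : 1 ≤ i) :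
    (insertSite π i).idxOf (n + 1) = n + 1 - i := by
  have hA : n + 1 ∉ π.take (n + 1 - i) := fun hx =>
    (h.lt_of_mem (List.mem_of_mem_take hx)).false
  rw [insertSite, h.length_eq, List.idxOf_append_of_notMem hA, List.idxOf_cons_self,
    List.length_take, h.length_eq]
  omega

theorem ncard_avoidsAll_321_312_succ {n : ℕ} (hn : 1 ≤ n) :
    {π : List ℕ | IsPermOf (n + 1) π ∧
        AvoidsAll ({[3, 2, 1], [3, 1, 2]} : Set (List ℕ)) π}.ncard =
      {π : List ℕ | IsPermOf n π ∧
        AvoidsAll ({[3, 2, 1], [3, 1, 2]} : Set (List ℕ)) π}.ncard * 2 := by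
  set S := {π : List ℕ | IsPermOf n π ∧
    AvoidsAll ({[3, 2, 1], [3, 1, 2]} : Set (List ℕ)) π}
  have himage : {π : List ℕ | IsPermOf (n + 1) π ∧
      AvoidsAll ({[3, 2, 1], [3, 1, 2]} : Set (List ℕ)) π} =
      (fun p : List ℕ × ℕ => insertSite p.1 p.2) '' (S ×ˢ ({1, 2} : Set ℕ)) := by
    ext π
    constructor
    · rintro ⟨hπ, hav⟩
      obtain ⟨ρ, i, hρ, hi₁, hi₂, rfl⟩ := exists_eq_insertSite hπ
      obtain ⟨hav', hi⟩ := (avoidsAll_insertSite_iff hρ hi₁ hi₂).1 hav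
      refine ⟨(ρ, i), ⟨⟨hρ, hav'⟩, ?_⟩, rfl⟩
      simp only [Set.mem_insert_iff, Set.mem_singleton_iff]
      omega
    · rintro ⟨⟨ρ, i⟩, ⟨⟨hρ, hav⟩, hi⟩, rfl⟩
      simp only [Set.mem_insert_iff, Set.mem_singleton_iff] at hi
      exact ⟨isPermOf_insertSite hρ i,
        (avoidsAll_insertSite_iff hρ (by omega) (by omega)).2 ⟨hav, by omega⟩⟩
  have hinj : Set.InjOn (fun p : List ℕ × ℕ => insertSite p.1 p.2)
      (S ×ˢ ({1, 2} : Set ℕ)) := by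
    rintro ⟨ρ, i⟩ ⟨⟨hρ, -⟩, hi⟩ ⟨σ, j⟩ ⟨⟨hσ, -⟩, hj⟩ heq
    simp only [Set.mem_insert_iff, Set.mem_singleton_iff] at hi hj heq
    have h₁ := congrArg (fun l => l.erase (n + 1)) heq
    have h₂ := congrArg (fun l => l.idxOf (n + 1)) heq
    simp only [erase_insertSite hρ, erase_insertSite hσ] at h₁
    simp only [idxOf_insertSite hρ (show 1 ≤ i by omega),
      idxOf_insertSite hσ (show 1 ≤ j by omega)] at h₂
    exact Prod.ext h₁ (show i = j by omega)
  rw [himage, hinj.ncard_image, Set.ncard_prod, Set.ncard_pair (by decide)]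

/-- For `T = {321, 312}`, a site `i` of a `T`-avoiding permutation `π` of `{1,…,n}` is
active if and only if `i ∈ {1,2}`; consequently the number of permutations of
`{1,…,n}` avoiding both `321` and `312` equals `2^{n-1}`. -/
theorem activeSites_of_321_312_and_count :
    ∀ n : ℕ, 1 ≤ n →
      (∀ π : List ℕ, IsPermOf n π →
        AvoidsAll ({[3, 2, 1], [3, 1, 2]} : Set (List ℕ)) π →
        ∀ i : ℕ, ActiveSite ({[3, 2, 1], [3, 1, 2]} : Set (List ℕ)) π i ↔
          (i = 1 ∨ i = 2)) ∧
      {π : List ℕ | IsPermOf n π ∧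
        AvoidsAll ({[3, 2, 1], [3, 1, 2]} : Set (List ℕ)) π}.ncard = 2 ^ (n - 1) := by
  intro n hn
  constructor
  · intro π hπ hav i
    rw [ActiveSite, hπ.length_eq]
    constructor
    · rintro ⟨hi₁, hi₂, h⟩
      have := ((avoidsAll_insertSite_iff hπ hi₁ hi₂).1 h).2
      omega
    · intro hi
      have hi₁ : 1 ≤ i := by omega
      have hi₂ : i ≤ n + 1 := by omega
      exact ⟨hi₁, hi₂, (avoidsAll_insertSite_iff hπ hi₁ hi₂).2 ⟨hav, by omega⟩⟩
  · induction n, hn using Nat.le_induction with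
    | base =>
      have : {π : List ℕ | IsPermOf 1 π ∧
          AvoidsAll ({[3, 2, 1], [3, 1, 2]} : Set (List ℕ)) π} = {[1]} := by
        ext π
        simp only [Set.mem_ofPred_eq, Set.mem_singleton_iff]
        constructor
        · rintro ⟨h, -⟩
          exact List.perm_singleton.1 h
        · rintro rfl
          refine ⟨List.Perm.refl _, (avoidsAll_321_312_iff (by simp)).2 ?_⟩
          intro a b c hs
          simpa using hs.length_le
      simp [this]
    | succ n hn ih =>
      rw [ncard_avoidsAll_321_312_succ hn, ih, ← pow_succ]
      congr 1
      omega
end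

section
/- For every n ≥ 0, the number of permutations of {1,…,n} avoiding the pattern 231 equals the n-th Catalan number c_n = (1/(n+1))·C(2n,n). -/
/-- `π` avoids the pattern 231: no `i < j < k` with `π(k) < π(i) < π(j)`. -/
def Avoids231 (π : List ℕ) : Prop :=
  ∀ i j k : ℕ, i < j → j < k → k < π.length →
    ¬(π.getD k 0 < π.getD i 0 ∧ π.getD i 0 < π.getD j 0)

theorem avoids231_iff_forall_sublist (π : List ℕ) :
    Avoids231 π ↔ ∀ a b c : ℕ, [a, b, c].Sublist π → ¬(c < a ∧ a < b) := by
  constructor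
  · intro h a b c hs
    obtain ⟨f, hf⟩ := List.sublist_iff_exists_orderEmbedding_getElem?_eq.1 hs
    have h0 := hf 0
    have h1 := hf 1
    have h2 := hf 2
    simp only [List.getElem?_cons_zero, List.getElem?_cons_succ] at h0 h1 h2
    have hlt : f 2 < π.length := by
      by_contra hge
      rw [List.getElem?_eq_none (not_lt.1 hge)] at h2
      cases h2
    have := h (f 0) (f 1) (f 2) (f.lt_iff_lt.2 (by decide)) (f.lt_iff_lt.2 (by decide)) hlt
    simpa [List.getD_eq_getElem?_getD, ← h0, ← h1, ← h2] using this
  · intro h i j k hij hjk hk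
    have hs : ([⟨i, by omega⟩, ⟨j, by omega⟩, ⟨k, hk⟩] : List (Fin π.length)).Pairwise (· < ·) := by
      simp [hij, hjk, hij.trans hjk]
    have := h _ _ _ (List.map_getElem_sublist hs)
    have hj : j < π.length := by omega
    have hi : i < π.length := by omega
    simpa [List.getD_eq_getElem?_getD, hi, hj, hk] using this

theorem Avoids231.of_sublist {l π : List ℕ} (h : Avoids231 π) (hl : l.Sublist π) :
    Avoids231 l := by
  rw [avoids231_iff_forall_sublist] at h ⊢
  exact fun a b c hs => h a b c (hs.trans hl)

/-- Two 231-avoiding lists, the first lying below the second, can be joined around a maximum. -/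
theorem Avoids231.append_cons {L R : List ℕ} {m : ℕ} (hL : Avoids231 L) (hR : Avoids231 R)
    (hLR : ∀ x ∈ L, ∀ y ∈ R, x < y) (hLm : ∀ x ∈ L, x < m) (hRm : ∀ y ∈ R, y < m) :
    Avoids231 (L ++ m :: R) := by
  rw [avoids231_iff_forall_sublist] at *
  rintro a b c hs ⟨hca, hab⟩
  obtain ⟨l₁, l₂, he, h₁, h₂⟩ := List.sublist_append_iff.1 hs
  have hmem : ∀ y ∈ l₂, y = m ∨ y ∈ R := fun y hy => by simpa using h₂.subset hy
  have hmem₁ : ∀ x ∈ l₁, x ∈ L := fun x hx => h₁.subset hx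
  match l₁, he with
  | [], he =>
    obtain rfl : [a, b, c] = l₂ := he
    rcases List.sublist_cons_iff.1 h₂ with h | ⟨r, hr, h⟩
    · exact hR a b c h ⟨hca, hab⟩
    · simp only [List.cons.injEq] at hr
      obtain ⟨rfl, rfl⟩ := hr
      have := hRm b (h.subset (by simp))
      omega
  | [x], he =>
    simp only [List.cons_append, List.nil_append, List.cons.injEq] at he
    obtain ⟨rfl, rfl⟩ := he
    have ha := hmem₁ a (by simp)
    rcases hmem c (by simp) with rfl | hc
    · have := hLm a ha
      omega
    · have := hLR a ha c hc
      omega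
  | [x, y], he =>
    simp only [List.cons_append, List.nil_append, List.cons.injEq] at he
    obtain ⟨rfl, rfl, rfl⟩ := he
    have ha := hmem₁ a (by simp)
    rcases hmem c (by simp) with rfl | hc
    · have := hLm a ha
      omega
    · have := hLR a ha c hc
      omega
  | x :: y :: z :: t, he =>
    simp only [List.cons_append, List.cons.injEq] at he
    obtain ⟨rfl, rfl, rfl, ht⟩ := he
    obtain ⟨rfl, -⟩ := List.append_eq_nil_iff.1 ht.symm
    exact hL a b c h₁ ⟨hca, hab⟩

theorem Avoids231.lt_of_append_cons {L R : List ℕ} {m : ℕ} (h : Avoids231 (L ++ m :: R))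
    (hnd : (L ++ m :: R).Nodup) (hLm : ∀ x ∈ L, x < m) :
    ∀ x ∈ L, ∀ y ∈ R, x < y := by
  intro x hx y hy
  have hs : [x, m, y].Sublist (L ++ m :: R) :=
    (List.singleton_sublist.2 hx).append ((List.singleton_sublist.2 hy).cons_cons m)
  have hnot := (avoids231_iff_forall_sublist _).1 h x m y hs
  have hne : x ≠ y := fun hxy =>
    (List.nodup_append.1 hnd).2.2 x hx y (List.mem_cons_of_mem _ hy) hxy
  have := hLm x hx
  omega

theorem perm_range'_of_append_perm_range' {L R : List ℕ} {s n : ℕ}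
    (h : (L ++ R).Perm (List.range' s n)) (hLR : ∀ x ∈ L, ∀ y ∈ R, x < y) :
    L.Perm (List.range' s L.length) ∧ R.Perm (List.range' (s + L.length) R.length) := by
  have hn : n = L.length + R.length := by simpa using h.length_eq.symm
  have hpL := List.mergeSort_perm L (· ≤ ·)
  have hpR := List.mergeSort_perm R (· ≤ ·)
  have hsorted : (L.mergeSort (· ≤ ·) ++ R.mergeSort (· ≤ ·)).Pairwise (· ≤ ·) :=
    List.pairwise_append.2 ⟨List.pairwise_mergeSort' _ _, List.pairwise_mergeSort' _ _,
      fun x hx y hy => (hLR x (hpL.subset hx) y (hpR.subset hy)).le⟩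
  have heq := ((hpL.append hpR).trans h).eq_of_pairwise' hsorted List.pairwise_le_range'
  have hsplit : List.range' s n =
      List.range' s L.length ++ List.range' (s + L.length) R.length := by
    rw [hn, List.range'_append_1]
  rw [hsplit] at heq
  obtain ⟨h₁, h₂⟩ := List.append_inj heq (by simp)
  exact ⟨h₁ ▸ hpL.symm, h₂ ▸ hpR.symm⟩

/-- The 231-avoiding arrangement of `s, s + 1, …` encoded by a binary tree: the root is the
position of the maximum, and everything before it lies below everything after it. -/
def BinaryTree.toAvoider : BinaryTree Unit → ℕ → List ℕ
  | .nil, _ => []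
  | .node _ l r, s =>
    l.toAvoider s ++ (s + l.numNodes + r.numNodes) :: r.toAvoider (s + l.numNodes)

theorem BinaryTree.toAvoider_perm (t : BinaryTree Unit) (s : ℕ) :
    (t.toAvoider s).Perm (List.range' s t.numNodes) := by
  induction t generalizing s with
  | nil => simp [toAvoider, numNodes]
  | node a l r ihl ihr =>
    have h : List.range' s (node a l r).numNodes =
        List.range' s l.numNodes ++ List.range' (s + l.numNodes) r.numNodes ++
          [s + l.numNodes + r.numNodes] := by
      rw [List.range'_append_1, numNodes, List.range'_1_concat, Nat.add_assoc]
    rw [h, toAvoider]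
    refine List.perm_middle.trans ?_
    refine (((ihl s).append (ihr _)).cons _).trans ?_
    exact (List.perm_append_singleton _ _).symm

theorem BinaryTree.length_toAvoider (t : BinaryTree Unit) (s : ℕ) :
    (t.toAvoider s).length = t.numNodes := by
  simpa using (t.toAvoider_perm s).length_eq

theorem BinaryTree.mem_toAvoider {t : BinaryTree Unit} {s x : ℕ} :
    x ∈ t.toAvoider s ↔ s ≤ x ∧ x < s + t.numNodes := by
  rw [(t.toAvoider_perm s).mem_iff, List.mem_range'_1]

theorem BinaryTree.avoids231_toAvoider (t : BinaryTree Unit) (s : ℕ) :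
    Avoids231 (t.toAvoider s) := by
  induction t generalizing s with
  | nil => simp [toAvoider, Avoids231]
  | node a l r ihl ihr =>
    refine (ihl s).append_cons (ihr _) ?_ ?_ ?_ <;> grind [mem_toAvoider]

theorem BinaryTree.toAvoider_injective (s : ℕ) :
    Function.Injective fun t : BinaryTree Unit => t.toAvoider s := by
  intro t t' h
  dsimp only at h
  induction t generalizing s t' with
  | nil =>
    cases t' with
    | nil => rfl
    | node => simp [toAvoider] at h
  | node a l r ihl ihr =>
    cases t' with
    | nil => simp [toAvoider] at h
    | node a' l' r' =>
      have hn : l.numNodes + r.numNodes = l'.numNodes + r'.numNodes := by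
        have := congrArg List.length h
        simp only [length_toAvoider, numNodes] at this
        omega
      have hlen : l.numNodes = l'.numNodes := by
        have hi := congrArg (List.idxOf (s + l.numNodes + r.numNodes)) h
        simp only [toAvoider] at hi
        rw [List.idxOf_append_of_notMem (by grind [mem_toAvoider]),
          List.idxOf_append_of_notMem (by grind [mem_toAvoider]), Nat.add_assoc s, hn,
          ← Nat.add_assoc] at hi
        simpa [length_toAvoider] using hi
      simp only [toAvoider] at h
      obtain ⟨h₁, h₂⟩ := List.append_inj h (by simp [length_toAvoider, hlen])
      rw [List.cons.injEq, ← hlen] at h₂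
      rw [ihl _ h₁, ihr _ h₂.2]

theorem BinaryTree.exists_toAvoider_eq {n s : ℕ} {π : List ℕ}
    (hp : π.Perm (List.range' s n)) (ha : Avoids231 π) :
    ∃ t : BinaryTree Unit, t.toAvoider s = π := by
  induction n using Nat.strong_induction_on generalizing s π with
  | _ n ih =>
    cases n with
    | zero => exact ⟨nil, by simpa [toAvoider] using hp.symm⟩
    | succ n =>
      have hm : s + n ∈ π := hp.mem_iff.2 (by simp)
      obtain ⟨L, R, rfl⟩ := List.append_of_mem hm
      have hnd : (L ++ (s + n) :: R).Nodup := hp.nodup_iff.2 List.nodup_range'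
      have hLRp : (L ++ R).Perm (List.range' s n) := by
        rw [List.range'_1_concat] at hp
        exact (List.perm_middle.symm.trans (hp.trans (List.perm_append_singleton _ _))).cons_inv
      have hLm : ∀ x ∈ L, x < s + n := fun x hx =>
        (List.mem_range'_1.1 (hLRp.subset (List.mem_append_left _ hx))).2
      have hlen : L.length + R.length = n := by simpa using hLRp.length_eq
      obtain ⟨hL, hR⟩ := perm_range'_of_append_perm_range' hLRp (ha.lt_of_append_cons hnd hLm)
      obtain ⟨l, hl⟩ := ih L.length (by omega) hL (ha.of_sublist (List.sublist_append_left _ _))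
      obtain ⟨r, hr⟩ := ih R.length (by omega) hR
        (ha.of_sublist ((List.sublist_cons_self _ _).trans (List.sublist_append_right _ _)))
      have hln : l.numNodes = L.length := by rw [← length_toAvoider l s, hl]
      have hrn : r.numNodes = R.length := by rw [← length_toAvoider r, hr]
      refine ⟨node () l r, ?_⟩
      rw [toAvoider, hln, hrn, hl, hr, Nat.add_assoc, hlen]

/-- The number of 231-avoiding permutations of `{1,…,n}` is the `n`-th Catalan number
`c_n = (1/(n+1))·C(2n,n)`. -/
theorem card_avoids231_eq_catalan (n : ℕ) :
    {π : List ℕ | IsPermOf n π ∧ Avoids231 π}.ncard = catalan n := by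
  have himage : {π : List ℕ | IsPermOf n π ∧ Avoids231 π} =
      (fun t : BinaryTree Unit => t.toAvoider 1) '' (BinaryTree.treesOfNumNodesEq n) := by
    ext π
    simp only [Set.mem_ofPred_eq, Set.mem_image, SetLike.mem_coe,
      BinaryTree.mem_treesOfNumNodesEq]
    constructor
    · rintro ⟨hp, ha⟩
      obtain ⟨t, rfl⟩ := BinaryTree.exists_toAvoider_eq hp ha
      exact ⟨t, by simpa [BinaryTree.length_toAvoider] using hp.length_eq, rfl⟩
    · rintro ⟨t, rfl, rfl⟩
      exact ⟨t.toAvoider_perm 1, t.avoids231_toAvoider 1⟩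
  rw [himage, Set.ncard_image_of_injective _ (BinaryTree.toAvoider_injective 1),
    Set.ncard_coe_finset, BinaryTree.treesOfNumNodesEq_card_eq_catalan]
end
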